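/- Fix ε ∈ (0,1], κ ∈ (0,1/6) and δ ∈ (0,1). For each integer m ≥ 1, let â_m := lim_{x→∞} a_m(x) (this limit exists). Then â_m ≪_{ε,κ,δ} m^{−3+δ} for all m ≥ 2; in particular, the series ∑_{m ≥ 0} â_m converges. -/

import Mathlib

open Finset Filter

noncomputable section

/-- `S ℓ p = ∑_{n ≤ ℓ} (n/p)`, the quadratic character sum (Legendre symbol for odd prime `p`). -/
def S (ℓ p : ℕ) : ℤ := ∑ n ∈ Finset.Icc 1 ℓ, jacobiSym (n : ℤ) p

/-- the first-passage time `f_ε(p) = min {ℓ ≥ 1 : S_ℓ(p) < ε ℓ}`. -/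
def fpt (ε : ℝ) (p : ℕ) : ℕ := sInf {ℓ : ℕ | 1 ≤ ℓ ∧ ((S ℓ p : ℝ)) < ε * ℓ}

/-- the odd primes up to a real number `x`. -/
def oddPrimesUpTo (x : ℝ) : Finset ℕ :=
  (Finset.range (⌊x⌋₊ + 1)).filter (fun p => p.Prime ∧ p ≠ 2)

/-- `π_odd(x)`, the number of odd primes up to `x`. -/
def piOdd (x : ℝ) : ℕ := (oddPrimesUpTo x).card

/-- `P_ℓ(x)`, the density of odd primes `p ≤ x` with `S_ℓ(p) ≥ ε ℓ`. -/
def Pdens (ε : ℝ) (ℓ : ℕ) (x : ℝ) : ℝ :=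
  (((oddPrimesUpTo x).filter (fun p => ε * ℓ ≤ (S ℓ p : ℝ))).card : ℝ) / (piOdd x : ℝ)

/-- `a_m(x) = N_m(x)/π_odd(x)`, the proportion of odd primes `p ≤ x` with `f_ε(p) > m`. -/
def aCoef (ε : ℝ) (m : ℕ) (x : ℝ) : ℝ :=
  (((oddPrimesUpTo x).filter (fun p => m < fpt ε p)).card : ℝ) / (piOdd x : ℝ)

/-- `c_u(ℓ)`, the number of triples `(a,b,c) ∈ {1,…,ℓ}³` with `abc = u`. -/
def cCoef (ℓ u : ℕ) : ℕ :=
  ((Finset.Icc 1 ℓ ×ˢ Finset.Icc 1 ℓ ×ˢ Finset.Icc 1 ℓ).filter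
    (fun t => t.1 * t.2.1 * t.2.2 = u)).card

/-- `C_3(ℓ) = ∑_{u,v ≤ ℓ³, uv = □} c_u(ℓ) c_v(ℓ)`. -/
def C3 (ℓ : ℕ) : ℕ :=
  ∑ q ∈ (Finset.Icc 1 (ℓ ^ 3) ×ˢ Finset.Icc 1 (ℓ ^ 3)).filter (fun q => IsSquare (q.1 * q.2)),
    cCoef ℓ q.1 * cCoef ℓ q.2


lemma divisor_bound (η : ℝ) (hη : 0 < η) :
    ∃ C : ℝ, 1 ≤ C ∧ ∀ n : ℕ, 1 ≤ n → ((n.divisors.card : ℕ) : ℝ) ≤ C * (n : ℝ) ^ η := by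
  have hl2 : 0 < Real.log 2 := Real.log_pos (by norm_num)
  set K : ℝ := 1 + 1 / (η * Real.log 2) with hK
  have hK1 : 1 ≤ K := by
    have : 0 < 1 / (η * Real.log 2) := by positivity
    linarith
  obtain ⟨B, hB⟩ := exists_nat_ge ((2:ℝ) ^ (1/η))
  refine ⟨K ^ B, one_le_pow₀ hK1, fun n hn => ?_⟩
  have hn0 : n ≠ 0 := by omega
  have key : ∀ p : ℕ, p.Prime → ∀ v : ℕ,
      ((v : ℝ) + 1) ≤ (if p < B then K else 1) * ((p : ℝ) ^ v) ^ η := by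
    intro p hp v
    have hp2 : (2:ℝ) ≤ p := by exact_mod_cast hp.two_le
    have hcomm : ((p : ℝ) ^ v) ^ η = ((p:ℝ) ^ η) ^ v := by
      rw [← Real.rpow_natCast, ← Real.rpow_natCast, ← Real.rpow_mul (by positivity),
        ← Real.rpow_mul (by positivity), mul_comm]
    rw [hcomm]
    split_ifs with h
    · have h1 : (2:ℝ)^η ≤ (p:ℝ)^η := Real.rpow_le_rpow (by norm_num) hp2 hη.le
      have h2 : ((2:ℝ)^η)^v ≤ ((p:ℝ)^η)^v := pow_le_pow_left₀ (by positivity) h1 v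
      have h3 : 1 + η * Real.log 2 * v ≤ ((2:ℝ)^η)^v := by
        rw [Real.rpow_def_of_pos (by norm_num), ← Real.exp_nat_mul]
        have := Real.add_one_le_exp ((v:ℝ) * (Real.log 2 * η))
        linarith
      calc (v:ℝ) + 1 ≤ K * (1 + η * Real.log 2 * v) := by
            have : K * (1 + η * Real.log 2 * v) = 1 + 1 / (η * Real.log 2) + η * Real.log 2 * v + v := by
              rw [hK]; field_simp; ring
            rw [this]
            have : 0 ≤ 1 / (η * Real.log 2) := by positivity
            have : 0 ≤ η * Real.log 2 * v := by positivity
            linarith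
        _ ≤ _ := by
            apply mul_le_mul_of_nonneg_left (h3.trans h2); linarith
    · push Not at h
      have h1 : (2:ℝ) ≤ (p:ℝ)^η := by
        have : (2:ℝ) ^ (1/η) ≤ p := hB.trans (by exact_mod_cast h)
        calc (2:ℝ) = ((2:ℝ) ^ (1/η)) ^ η := by
              rw [← Real.rpow_mul (by norm_num)]; field_simp; simp
          _ ≤ _ := Real.rpow_le_rpow (by positivity) this hη.le
      have h2 : (2:ℝ)^v ≤ ((p:ℝ)^η)^v := pow_le_pow_left₀ (by positivity) h1 v
      have h3 : ((v:ℝ) + 1) ≤ (2:ℝ)^v := by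
        exact_mod_cast (Nat.lt_two_pow_self (n := v))
      linarith
  rw [Nat.card_divisors hn0]
  push_cast
  calc ∏ p ∈ n.primeFactors, ((n.factorization p : ℝ) + 1)
      ≤ ∏ p ∈ n.primeFactors, ((if p < B then K else 1) * ((p : ℝ) ^ (n.factorization p)) ^ η) :=
        Finset.prod_le_prod (fun _ _ => by positivity)
          (fun p hp => key p (Nat.prime_of_mem_primeFactors hp) _)
    _ = (∏ p ∈ n.primeFactors, (if p < B then K else 1)) * (n:ℝ)^η := by
        rw [Finset.prod_mul_distrib, Real.finsetProd_rpow _ _ (fun _ _ => by positivity)]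
        congr 2
        have := Nat.prod_factorization_pow_eq_self hn0
        rw [Finsupp.prod, Nat.support_factorization] at this
        exact_mod_cast this
    _ ≤ K ^ B * (n:ℝ)^η := by
        apply mul_le_mul_of_nonneg_right _ (by positivity)
        rw [← Finset.prod_filter, Finset.prod_const]
        apply pow_le_pow_right₀ hK1
        calc _ ≤ (Finset.range B).card := Finset.card_le_card (by
                intro p; simp)
          _ = B := by simp

lemma count_bound (δ : ℝ) (hδ : 0 < δ) :
    ∃ C : ℝ, 0 < C ∧ ∀ m : ℕ, 1 ≤ m →
      ((((Fintype.piFinset (fun _ : Fin 6 => Finset.Icc 1 m)).filter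
        (fun t => IsSquare (∏ i, t i))).card : ℕ) : ℝ) ≤ C * (m : ℝ) ^ (3 + δ) := by
  obtain ⟨C, hC1, hC⟩ := divisor_bound (δ / 36) (by positivity)
  refine ⟨C ^ 6, by positivity, fun m hm => ?_⟩
  have hm0 : (0:ℝ) < m := by exact_mod_cast hm
  have hsub : (Fintype.piFinset (fun _ : Fin 6 => Finset.Icc 1 m)).filter
        (fun t => IsSquare (∏ i, t i)) ⊆
      (Finset.Icc 1 (m^3)).biUnion
        (fun w => Fintype.piFinset (fun _ : Fin 6 => (w^2).divisors)) := by
    intro t ht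
    simp only [Finset.mem_filter, Fintype.mem_piFinset, Finset.mem_Icc] at ht
    obtain ⟨h1, w, hw⟩ := ht
    have hpos : 0 < ∏ i, t i := Finset.prod_pos fun i _ => (h1 i).1
    have hle : ∏ i, t i ≤ m ^ 6 := by
      calc ∏ i, t i ≤ ∏ i : Fin 6, m := Finset.prod_le_prod' fun i _ => (h1 i).2
        _ = m ^ 6 := by simp
    have hw0 : 0 < w := by
      rcases Nat.eq_zero_or_pos w with h | h
      · subst h; omega
      · exact h
    simp only [Finset.mem_biUnion, Finset.mem_Icc, Fintype.mem_piFinset, Nat.mem_divisors]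
    refine ⟨w, ⟨hw0, ?_⟩, fun i => ⟨?_, by positivity⟩⟩
    · have : w ^ 2 ≤ (m^3)^2 := by
        calc w ^ 2 = ∏ i, t i := by rw [hw, sq]
          _ ≤ m ^ 6 := hle
          _ = _ := by ring
      exact (Nat.pow_le_pow_iff_left (by norm_num)).1 this
    · rw [sq, ← hw]; exact Finset.dvd_prod_of_mem _ (Finset.mem_univ i)
  have h1 := (Finset.card_le_card hsub).trans Finset.card_biUnion_le
  calc _ ≤ ((∑ w ∈ Finset.Icc 1 (m^3),
        (Fintype.piFinset (fun _ : Fin 6 => (w^2).divisors)).card : ℕ) : ℝ) := by exact_mod_cast h1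
    _ = ∑ w ∈ Finset.Icc 1 (m^3), (((w^2).divisors.card : ℕ) : ℝ) ^ 6 := by
        push_cast
        apply Finset.sum_congr rfl
        intro w _
        rw [Fintype.card_piFinset]; simp
    _ ≤ ∑ w ∈ Finset.Icc 1 (m^3), (C * ((m:ℝ)^6) ^ (δ/36)) ^ 6 := by
        apply Finset.sum_le_sum
        intro w hw
        rw [Finset.mem_Icc] at hw
        apply pow_le_pow_left₀ (by positivity)
        refine (hC (w^2) (by nlinarith)).trans ?_
        apply mul_le_mul_of_nonneg_left _ (by linarith)
        apply Real.rpow_le_rpow (by positivity) _ (by positivity)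
        have : w ^ 2 ≤ m ^ 6 := by
          calc w ^ 2 ≤ (m^3)^2 := Nat.pow_le_pow_left hw.2 2
            _ = _ := by ring
        exact_mod_cast this
    _ = C ^ 6 * (m:ℝ) ^ (3 + δ) := by
        rw [Finset.sum_const, Nat.card_Icc, nsmul_eq_mul, mul_pow, Real.rpow_add hm0]
        have : (((m:ℝ)^6) ^ (δ/36)) ^ 6 = (m:ℝ) ^ δ := by
          rw [← Real.rpow_natCast, ← Real.rpow_natCast, ← Real.rpow_mul (by positivity),
            ← Real.rpow_mul (by positivity)]
          congr 1; push_cast; ring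
        rw [this]
        have : (m:ℝ) ^ (3:ℝ) = (m:ℝ)^3 := by exact_mod_cast Real.rpow_natCast (m:ℝ) 3
        rw [this]; push_cast [Nat.add_sub_cancel]; ring

open ArithmeticFunction ArithmeticFunction.vonMangoldt Complex in
lemma rc_bound {q : ℕ} [NeZero q] {a : ZMod q} (ha : IsUnit a) :
    ∃ C : ℝ, ∀ x : ℝ, x ∈ Set.Ioc (1:ℝ) 2 →
      ∑' n, residueClass a n / (n : ℝ) ^ x ≤ (q.totient : ℝ)⁻¹ / (x - 1) + C := by
  have H {x : ℝ} (hx : 1 < x) :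
      ∑' n, residueClass a n / (n : ℝ) ^ x =
        (LFunctionResidueClassAux a x).re + (q.totient : ℝ)⁻¹ / (x - 1) := by
    refine ofReal_injective ?_
    simp only [ofReal_tsum, ofReal_div, ofReal_cpow (Nat.cast_nonneg _), ofReal_natCast,
      ofReal_add, ofReal_inv, ofReal_sub, ofReal_one]
    simp_rw [← LFunctionResidueClassAux_real ha hx,
      eqOn_LFunctionResidueClassAux ha <| Set.mem_ofPred.mpr (ofReal_re x ▸ hx), sub_add_cancel,
      LSeries, LSeries.term]
    refine tsum_congr fun n ↦ ?_
    split_ifs with hn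
    · simp only [hn, residueClass_apply_zero, ofReal_zero, zero_div]
    · rfl
  have : ContinuousOn (fun x : ℝ ↦ (LFunctionResidueClassAux a x).re) (Set.Icc 1 2) :=
    continuous_re.continuousOn.comp (t := Set.univ) (continuousOn_LFunctionResidueClassAux a)
      (fun ⦃x⦄ a ↦ trivial) |>.comp continuous_ofReal.continuousOn fun x hx ↦ by
        simpa only [Set.mem_ofPred_eq, ofReal_re] using hx.1
  obtain ⟨C, hC⟩ := bddAbove_def.mp <| IsCompact.bddAbove_image isCompact_Icc this
  replace hC {x : ℝ} (hx : x ∈ Set.Icc 1 2) : (LFunctionResidueClassAux a x).re ≤ C :=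
    hC (LFunctionResidueClassAux a x).re <|
      Set.mem_image_of_mem (fun x : ℝ ↦ (LFunctionResidueClassAux a x).re) hx
  refine ⟨C, fun x hx ↦ ?_⟩
  rw [H hx.1, add_comm, add_le_add_iff_left]
  exact hC <| Set.mem_Icc_of_Ioc hx

open ArithmeticFunction ArithmeticFunction.vonMangoldt in
lemma rc_summable {q : ℕ} (a : ZMod q) {x : ℝ} (hx : 1 < x) :
    Summable (fun n : ℕ => residueClass a n / (n : ℝ) ^ x) := by
  have h : LSeriesSummable (fun n => ((residueClass a n : ℝ) : ℂ)) (x : ℂ) := by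
    apply LSeriesSummable_of_abscissaOfAbsConv_lt_re
    refine lt_of_le_of_lt (abscissaOfAbsConv_residueClass_le_one a) ?_
    simpa using (by exact_mod_cast hx : (1 : EReal) < (x : EReal))
  have := h.norm
  refine this.congr fun n => ?_
  rw [LSeries.norm_term_eq]
  split_ifs with hn
  · simp [hn]
  · simp [abs_of_nonneg (residueClass_nonneg a n)]

lemma abel_bound (D g : ℕ → ℝ) (K : ℝ) (hK : 0 ≤ K) (hg : Antitone g) (hg0 : ∀ n, 0 ≤ g n)
    (hD : ∀ N, -K ≤ ∑ i ∈ Finset.range N, D i) (N : ℕ) :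
    -K * g 0 ≤ ∑ i ∈ Finset.range N, D i * g i := by
  have key : ∀ N, (K + ∑ i ∈ Finset.range (N+1), D i) * g N - K * g 0 ≤
      ∑ i ∈ Finset.range (N+1), D i * g i := by
    intro N
    induction N with
    | zero => simp; nlinarith
    | succ N ih =>
      rw [Finset.sum_range_succ, Finset.sum_range_succ (fun i => D i * g i)]
      have h1 := hD (N+1)
      have h2 : g (N+1) ≤ g N := hg (Nat.le_succ N)
      have := mul_le_mul_of_nonneg_left h2 (by linarith : 0 ≤ K + ∑ i ∈ Finset.range (N+1), D i)
      nlinarith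
  cases N with
  | zero => simp; exact mul_nonneg hK (hg0 0)
  | succ N =>
    have := key N
    have h1 := hD (N+1)
    have := mul_nonneg (by linarith : 0 ≤ K + ∑ i ∈ Finset.range (N+1), D i) (hg0 N)
    linarith


lemma isSquare_of_even_fact {u : ℕ} (hu : u ≠ 0) (h : ∀ p, p.Prime → Even (u.factorization p)) :
    IsSquare u := by
  rw [← Nat.prod_factorization_pow_eq_self hu, Finsupp.prod]
  refine ⟨∏ p ∈ u.factorization.support, p ^ (u.factorization p / 2), ?_⟩
  rw [← Finset.prod_mul_distrib]
  apply Finset.prod_congr rfl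
  intro p hp
  have hp' : p.Prime := Nat.prime_of_mem_primeFactors (by simpa using hp)
  rw [← pow_add]
  congr 1
  obtain ⟨k, hk⟩ := h p hp'
  omega

lemma jac_one {p b : ℕ} (hp : Odd p) (hb : b % 4 = 1) (hbp : b ≡ 1 [MOD p]) :
    jacobiSym (p : ℤ) b = 1 := by
  rw [jacobiSym.quadratic_reciprocity_one_mod_four' hp hb]
  rw [jacobiSym.mod_left' (a₂ := 1), jacobiSym.one_left]
  exact_mod_cast hbp

lemma exists_sep (m ℓ : ℕ) (hℓ : ℓ.Prime) :
    ∃ b : ℕ, b.Coprime (8 * m.factorial) ∧ jacobiSym (ℓ : ℤ) b = -1 ∧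
      ∀ p : ℕ, p.Prime → p ≤ m → p ≠ ℓ → jacobiSym (p : ℤ) b = 1 := by
  set Q := 8 * m.factorial with hQ
  have hQ0 : Q ≠ 0 := by have := m.factorial_pos; omega
  set M := ordCompl[ℓ] Q with hM
  have hprod : ordProj[ℓ] Q * M = Q := Nat.ordProj_mul_ordCompl_eq_self Q ℓ
  have hcop : ℓ.Coprime M := Nat.coprime_ordCompl hℓ hQ0
  have hpM : ∀ p : ℕ, p.Prime → p ≤ m → p ≠ ℓ → p ∣ M := by
    intro p hp hpm hpl
    have h1 : p ∣ ordProj[ℓ] Q * M := by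
      rw [hprod]; exact Dvd.dvd.mul_left ((hp.dvd_factorial).2 hpm) 8
    rcases (hp.dvd_mul).1 h1 with h | h
    · exact absurd ((Nat.prime_dvd_prime_iff_eq hp hℓ).1 (hp.dvd_of_dvd_pow h)) hpl
    · exact h
  have hbc : ∀ b : ℕ, b ≡ 1 [MOD M] → b.Coprime ℓ → b.Coprime Q := by
    intro b h1 h2
    rw [← hprod]
    apply Nat.Coprime.mul_right (Nat.Coprime.pow_right _ h2)
    have := h1.gcd_eq
    simpa [Nat.Coprime] using this
  rcases hℓ.eq_two_or_odd' with h2 | hodd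
  · have hc8 : M.Coprime 8 := by
      rw [h2] at hcop
      have : (2^3).Coprime M := Nat.Coprime.pow_left 3 hcop
      exact this.symm
    obtain ⟨b, hb1, hb2⟩ := Nat.chineseRemainder hc8 1 5
    have hb8 : b % 8 = 5 := hb2
    have hbo : Odd b := Nat.odd_iff.2 (by omega)
    refine ⟨b, hbc b hb1 ?_, ?_, ?_⟩
    · rw [h2]; exact hbo.coprime_two_right
    · rw [h2]
      have := jacobiSym.at_two hbo
      push_cast
      rw [this, ZMod.χ₈_nat_eq_if_mod_eight]
      simp [hb8]; omega
    · intro p hp hpm hpl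
      have hpo : Odd p := hp.odd_of_ne_two (by rwa [h2] at hpl)
      exact jac_one hpo (by omega) (hb1.of_dvd (hpM p hp hpm hpl))
  · have : Fact ℓ.Prime := ⟨hℓ⟩
    have hl2 : ℓ ≠ 2 := by rintro rfl; revert hodd; decide
    obtain ⟨x, hx⟩ := FiniteField.exists_nonsquare (F := ZMod ℓ)
      (by rw [ZMod.ringChar_zmod_n]; exact hl2)
    have h8M : 8 ∣ M := by
      have h1 : 8 ∣ ordProj[ℓ] Q * M := by rw [hprod]; exact dvd_mul_right _ _
      have : Nat.Coprime 8 (ordProj[ℓ] Q) := by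
        apply Nat.Coprime.pow_right
        exact (Nat.Coprime.pow_left 3 (hodd.coprime_two_left) : Nat.Coprime (2^3) ℓ)
      exact this.dvd_of_dvd_mul_left h1
    obtain ⟨b, hb1, hb2⟩ := Nat.chineseRemainder hcop.symm 1 x.val
    have hbx : (b : ZMod ℓ) = x := by
      rw [(ZMod.natCast_eq_natCast_iff _ _ _).2 hb2]; simp
    have hb8 : b % 8 = 1 := hb1.of_dvd h8M
    refine ⟨b, hbc b hb1 ?_, ?_, ?_⟩
    · rw [Nat.coprime_comm, hℓ.coprime_iff_not_dvd, ← ZMod.natCast_eq_zero_iff, hbx]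
      rintro rfl; exact hx (IsSquare.zero)
    · rw [jacobiSym.quadratic_reciprocity_one_mod_four' hodd (by omega),
        ZMod.nonsquare_iff_jacobiSym_eq_neg_one]
      simpa [hbx] using hx
    · intro p hp hpm hpl
      rcases hp.eq_two_or_odd' with h | h
      · subst h
        have hbo : Odd b := Nat.odd_iff.2 (by omega)
        have := jacobiSym.at_two hbo
        push_cast
        rw [this, ZMod.χ₈_nat_eq_if_mod_eight]
        simp [hb8]; omega
      · exact jac_one h (by omega) (hb1.of_dvd (hpM p hp hpm hpl))

lemma jac_factor (u b : ℕ) (hu : u ≠ 0) :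
    jacobiSym (u : ℤ) b = ∏ p ∈ u.primeFactors, jacobiSym (p : ℤ) b ^ (u.factorization p) := by
  have h : ∀ s : Finset ℕ, ∀ f : ℕ → ℕ, jacobiSym ((∏ p ∈ s, p ^ f p : ℕ) : ℤ) b =
      ∏ p ∈ s, jacobiSym (p : ℤ) b ^ f p := by
    intro s f
    induction s using Finset.induction_on with
    | empty => simp [jacobiSym.one_left]
    | insert a s ha ih =>
      rw [Finset.prod_insert ha, Finset.prod_insert ha, Nat.cast_mul, jacobiSym.mul_left, ih,
        Nat.cast_pow, jacobiSym.pow_left]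
  have := Nat.prod_factorization_pow_eq_self hu
  rw [Finsupp.prod, Nat.support_factorization] at this
  rw [← h, this]

lemma jac_prod (t : Fin 6 → ℕ) (b : ℕ) :
    jacobiSym ((∏ i, t i : ℕ) : ℤ) b = ∏ i, jacobiSym (t i : ℤ) b := by
  simp [Fin.prod_univ_succ, jacobiSym.mul_left]

lemma jac_per {m n b b' : ℕ} (hn : n ∈ Finset.Icc 1 m) (hb : Odd b)
    (h : b ≡ b' [MOD 8 * m.factorial]) : jacobiSym (n : ℤ) b = jacobiSym (n : ℤ) b' := by
  rw [Finset.mem_Icc] at hn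
  have hb' : Odd b' := by
    have : b ≡ b' [MOD 2] := h.of_dvd (Dvd.dvd.mul_right (by norm_num) _)
    rw [Nat.odd_iff] at *
    exact this ▸ hb
  have hd : 4 * n ∣ 8 * m.factorial :=
    mul_dvd_mul (by norm_num) (Nat.dvd_factorial (by omega) hn.2)
  have h4 : b ≡ b' [MOD 4 * n] := h.of_dvd hd
  rw [jacobiSym.mod_right' n hb, jacobiSym.mod_right' n hb', h4]

lemma S_per {m b b' : ℕ} (hb : Odd b)
    (h : b ≡ b' [MOD 8 * m.factorial]) : S m b = S m b' :=
  Finset.sum_congr rfl fun _ hn => jac_per hn hb h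

lemma unit_odd {m : ℕ} (a : (ZMod (8 * m.factorial))ˣ) : Odd (a : ZMod (8 * m.factorial)).val := by
  have h := ZMod.val_coe_unit_coprime a
  have : Nat.Coprime (a : ZMod (8 * m.factorial)).val 2 :=
    h.of_dvd_right (Dvd.dvd.mul_right (by norm_num) _)
  exact Nat.coprime_two_right.1 this

lemma char_sum_zero (m : ℕ) (t : Fin 6 → ℕ) (ht : ∀ i, t i ∈ Finset.Icc 1 m)
    (hsq : ¬ IsSquare (∏ i, t i)) [NeZero (8 * m.factorial)] :
    ∑ a : (ZMod (8 * m.factorial))ˣ,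
      ∏ i, jacobiSym (t i : ℤ) (a : ZMod (8 * m.factorial)).val = 0 := by
  have ht' : ∀ i, 1 ≤ t i ∧ t i ≤ m := fun i => Finset.mem_Icc.1 (ht i)
  have hu : ∏ i, t i ≠ 0 := Finset.prod_ne_zero_iff.2 fun i _ => by have := ht' i; omega
  have : ∃ ℓ, ℓ.Prime ∧ ¬ Even ((∏ i, t i).factorization ℓ) := by
    by_contra hc
    push Not at hc
    exact hsq (isSquare_of_even_fact hu hc)
  obtain ⟨ℓ, hℓ, hodd⟩ := this
  rw [Nat.not_even_iff_odd] at hodd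
  obtain ⟨b, hbc, hb1, hb2⟩ := exists_sep m ℓ hℓ
  have hJ : ∏ i, jacobiSym (t i : ℤ) b = -1 := by
    rw [← jac_prod, jac_factor _ _ hu, Finset.prod_eq_single ℓ]
    · rw [hb1, hodd.neg_one_pow]
    · intro p hp hpl
      have hpp := Nat.prime_of_mem_primeFactors hp
      obtain ⟨i, _, hi⟩ := (hpp.prime.dvd_finsetProd_iff _).1 (Nat.dvd_of_mem_primeFactors hp)
      rw [hb2 p hpp ((Nat.le_of_dvd (ht' i).1 hi).trans (ht' i).2) hpl, one_pow]
    · intro h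
      rw [← Nat.support_factorization, Finsupp.notMem_support_iff] at h
      rw [h] at hodd; exact absurd hodd (by decide)
  set β := ZMod.unitOfCoprime b hbc with hβ
  have hbo : Odd b := Nat.coprime_two_right.1
    (hbc.of_dvd_right (Dvd.dvd.mul_right (by norm_num) _))
  have hshift := Equiv.sum_comp (Equiv.mulLeft β) (fun a : (ZMod (8 * m.factorial))ˣ =>
      ∏ i, jacobiSym (t i : ℤ) (a : ZMod (8 * m.factorial)).val)
  have hmul : ∀ a : (ZMod (8 * m.factorial))ˣ,
      ∏ i, jacobiSym (t i : ℤ) ((β * a : (ZMod (8 * m.factorial))ˣ) : ZMod (8 * m.factorial)).val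
      = - ∏ i, jacobiSym (t i : ℤ) (a : ZMod (8 * m.factorial)).val := by
    intro a
    rw [← neg_one_mul, ← hJ, ← Finset.prod_mul_distrib]
    apply Finset.prod_congr rfl
    intro i _
    rw [← jacobiSym.mul_right' _ hbo.pos.ne' (unit_odd a).pos.ne']
    apply jac_per (ht i) (unit_odd _)
    rw [← ZMod.natCast_eq_natCast_iff]
    simp [hβ]
  simp only [Equiv.coe_mulLeft, hmul, Finset.sum_neg_distrib] at hshift
  linarith

lemma moment_bound (m : ℕ) [NeZero (8 * m.factorial)] :
    ∑ a : (ZMod (8 * m.factorial))ˣ, (S m (a : ZMod (8 * m.factorial)).val) ^ 6 ≤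
      ((8 * m.factorial).totient : ℤ) *
      (((Fintype.piFinset (fun _ : Fin 6 => Finset.Icc 1 m)).filter
        (fun t => IsSquare (∏ i, t i))).card : ℤ) := by
  simp only [S, Finset.sum_pow']
  rw [Finset.sum_comm, ← Finset.sum_filter_add_sum_filter_not _ (fun t => IsSquare (∏ i, t i)),
    mul_comm ((8 * m.factorial).totient : ℤ)]
  have h0 : ∑ t ∈ (Fintype.piFinset (fun _ : Fin 6 => Finset.Icc 1 m)).filter
        (fun t => ¬ IsSquare (∏ i, t i)), ∑ a : (ZMod (8 * m.factorial))ˣ,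
      ∏ i, jacobiSym (t i : ℤ) (a : ZMod (8 * m.factorial)).val = 0 := by
    apply Finset.sum_eq_zero
    intro t ht
    rw [Finset.mem_filter, Fintype.mem_piFinset] at ht
    exact char_sum_zero m t ht.1 ht.2
  rw [h0, add_zero, ← nsmul_eq_mul]
  apply Finset.sum_le_card_nsmul
  intro t _
  calc _ ≤ ∑ a : (ZMod (8 * m.factorial))ˣ, (1 : ℤ) := by
        apply Finset.sum_le_sum
        intro a _
        rw [← jac_prod]
        rcases jacobiSym.trichotomy ((∏ i, t i : ℕ) : ℤ) (a : ZMod (8 * m.factorial)).val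
          with h | h | h <;> rw [h] <;> norm_num
    _ = _ := by
        rw [Finset.sum_const, Finset.card_univ, ZMod.card_units_eq_totient]; simp

def gfun (s : ℝ) (n : ℕ) : ℝ := Real.log ((max n 3 : ℕ) : ℝ) / ((max n 3 : ℕ) : ℝ) ^ s

lemma gfun_anti {s : ℝ} (hs : 1 < s) : Antitone (gfun s) := by
  intro a b hab
  have hE : Real.exp s⁻¹ ≤ 3 := by
    have h1 : s⁻¹ ≤ 1 := inv_le_one_of_one_le₀ hs.le
    have := Real.exp_le_exp.2 h1
    have := Real.exp_one_lt_d9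
    linarith
  have h3 : ∀ n : ℕ, (3:ℝ) ≤ ((max n 3 : ℕ) : ℝ) := fun n => by
    exact_mod_cast le_max_right n 3
  exact Real.log_div_self_rpow_antitoneOn (by linarith : 0 < s)
    (Set.mem_Ici.2 (hE.trans (h3 a))) (Set.mem_Ici.2 (hE.trans (h3 b)))
    (by exact_mod_cast max_le_max_right 3 hab)

lemma gfun_nonneg (s : ℝ) (n : ℕ) : 0 ≤ gfun s n := by
  unfold gfun
  apply div_nonneg
  · exact Real.log_natCast_nonneg _
  · positivity

lemma gfun_zero {s : ℝ} (hs : 1 < s) : gfun s 0 ≤ 2 := by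
  unfold gfun
  have h1 : Real.log 3 ≤ 2 := by
    have := Real.log_le_sub_one_of_pos (by norm_num : (0:ℝ) < 3); linarith
  have h2 : (1:ℝ) ≤ 3 ^ s := Real.one_le_rpow (by norm_num) (by linarith)
  have h0 : 0 ≤ Real.log 3 := Real.log_nonneg (by norm_num)
  norm_num
  exact (div_le_self h0 h2).trans h1

lemma gfun_prime (s : ℝ) {n : ℕ} (hn : n.Prime) (h2 : n ≠ 2) :
    gfun s n = ArithmeticFunction.vonMangoldt n / (n : ℝ) ^ s := by
  have : max n 3 = n := by
    have := hn.two_le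
    omega
  rw [gfun, this, ArithmeticFunction.vonMangoldt_apply_prime hn]

lemma S_of_fpt {ε : ℝ} {m p : ℕ} (hm : 1 ≤ m) (h : m < fpt ε p) : ε * m ≤ (S m p : ℝ) := by
  by_contra hc
  push Not at hc
  have : fpt ε p ≤ m := Nat.sInf_le ⟨hm, hc⟩
  omega

open ArithmeticFunction.vonMangoldt in
lemma lower_pt {s : ℝ} (hs : 1 < s) (n : ℕ) :
    residueClass (1 : ZMod 1) n / (n : ℝ) ^ s ≤
      (if n.Prime ∧ n ≠ 2 then gfun s n else 0) +
        (if n.Prime then 0 else residueClass (1 : ZMod 1) n) / n + (if n = 2 then 1 else 0) := by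
  have hr : residueClass (1 : ZMod 1) n = ArithmeticFunction.vonMangoldt n := by
    simp [residueClass, Set.indicator, eq_iff_true_of_subsingleton]
  by_cases hp : n.Prime
  · by_cases h2 : n = 2
    · subst h2
      have h1 : (1:ℝ) ≤ 2 ^ s := Real.one_le_rpow (by norm_num) (by linarith)
      have h0 : 0 ≤ Real.log 2 := Real.log_nonneg (by norm_num)
      have h3 : Real.log 2 ≤ 1 := by
        have := Real.log_le_sub_one_of_pos (by norm_num : (0:ℝ) < 2); linarith
      have := (div_le_self h0 h1).trans h3
      rw [hr, ArithmeticFunction.vonMangoldt_apply_prime hp]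
      simpa [Nat.prime_two] using this
    · simp [hp, h2, gfun_prime s hp h2, hr]
  · have h2 : n ≠ 2 := by rintro rfl; exact hp Nat.prime_two
    simp only [hp, h2, false_and, if_false, zero_add, add_zero]
    rcases Nat.eq_zero_or_pos n with h | h
    · subst h; simp
    · have h1 : (1:ℝ) ≤ n := by exact_mod_cast h
      apply div_le_div_of_nonneg_left (residueClass_nonneg _ _) (by linarith)
      simpa using Real.rpow_le_rpow_of_exponent_le h1 hs.le

open ArithmeticFunction.vonMangoldt in
lemma upper_pt {ε s : ℝ} (hε : 0 < ε) {m : ℕ} (hm : 1 ≤ m) [NeZero (8 * m.factorial)] (n : ℕ) :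
    (if (n.Prime ∧ n ≠ 2) ∧ m < fpt ε n ∧ 8 * m.factorial < n then gfun s n else 0) ≤
      ∑ a : (ZMod (8 * m.factorial))ˣ,
        ((S m (a : ZMod (8 * m.factorial)).val : ℝ) / (ε * m)) ^ 6 *
          (residueClass (a : ZMod (8 * m.factorial)) n / (n : ℝ) ^ s) := by
  have hnn : ∀ a : (ZMod (8 * m.factorial))ˣ, 0 ≤
      ((S m (a : ZMod (8 * m.factorial)).val : ℝ) / (ε * m)) ^ 6 *
          (residueClass (a : ZMod (8 * m.factorial)) n / (n : ℝ) ^ s) := fun a =>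
    mul_nonneg (Even.pow_nonneg (by decide) _)
      (div_nonneg (residueClass_nonneg _ _) (by positivity))
  split_ifs with h
  · obtain ⟨⟨hp, h2⟩, hf, hQ⟩ := h
    have hc : n.Coprime (8 * m.factorial) := by
      rw [hp.coprime_iff_not_dvd]
      intro hd
      have := Nat.le_of_dvd (NeZero.pos _) hd
      omega
    have hno : Odd n := hp.odd_of_ne_two h2
    set α := ZMod.unitOfCoprime n hc with hα
    have hSα : S m (α : ZMod (8 * m.factorial)).val = S m n := by
      symm
      apply S_per hno
      rw [← ZMod.natCast_eq_natCast_iff]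
      simp [hα]
    refine le_trans ?_ (Finset.single_le_sum (fun a _ => hnn a) (Finset.mem_univ α))
    have hr : residueClass (α : ZMod (8 * m.factorial)) n = ArithmeticFunction.vonMangoldt n := by
      simp [residueClass, Set.indicator, hα]
    rw [hSα, hr, gfun_prime s hp h2]
    have hm' : (0:ℝ) < m := by exact_mod_cast hm
    have h1 : 1 ≤ ((S m n : ℝ) / (ε * m)) ^ 6 := by
      apply one_le_pow₀
      rw [le_div_iff₀ (by positivity), one_mul]
      exact S_of_fpt hm hf
    exact le_mul_of_one_le_left
      (div_nonneg ArithmeticFunction.vonMangoldt_nonneg (by positivity)) h1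
  · exact Finset.sum_nonneg fun a _ => hnn a

lemma partial_lower {ε c : ℝ} {m x0 : ℕ} (hc : 0 ≤ c) (Q : ℕ)
    (hx : ∀ N : ℕ, x0 ≤ N → c ≤ aCoef ε m (N : ℝ)) (N : ℕ) :
    -((Q : ℝ) + 1 + c * x0) ≤ ∑ n ∈ Finset.range N,
      ((if (n.Prime ∧ n ≠ 2) ∧ m < fpt ε n ∧ Q < n then (1:ℝ) else 0) -
        c * (if n.Prime ∧ n ≠ 2 then 1 else 0)) := by
  rw [Finset.sum_sub_distrib, ← Finset.mul_sum, Finset.sum_boole, Finset.sum_boole]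
  rcases le_or_gt N x0 with h | h
  · have h1 : (((Finset.range N).filter (fun n => n.Prime ∧ n ≠ 2)).card : ℝ) ≤ x0 := by
      have := (Finset.card_filter_le (Finset.range N) (fun n => n.Prime ∧ n ≠ 2))
      rw [Finset.card_range] at this
      exact_mod_cast this.trans h
    have := mul_le_mul_of_nonneg_left h1 hc
    have h2 : (0:ℝ) ≤ (((Finset.range N).filter
      (fun n => (n.Prime ∧ n ≠ 2) ∧ m < fpt ε n ∧ Q < n)).card : ℝ) := by positivity
    have h3 : (0:ℝ) ≤ Q := by positivity
    linarith
  · obtain ⟨M, rfl⟩ : ∃ M, N = M + 1 := ⟨N - 1, by omega⟩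
    have h1 := hx M (by omega)
    have hodd : oddPrimesUpTo (M : ℝ) = (Finset.range (M+1)).filter (fun n => n.Prime ∧ n ≠ 2) := by
      simp [oddPrimesUpTo]
    have h2 : c * (piOdd (M : ℝ) : ℝ) ≤
        ((oddPrimesUpTo (M:ℝ)).filter (fun p => m < fpt ε p)).card := by
      rcases Nat.eq_zero_or_pos (piOdd (M:ℝ)) with h0 | h0
      · rw [h0]; simp
      · rw [aCoef, le_div_iff₀ (by exact_mod_cast h0)] at h1
        exact h1
    rw [piOdd, hodd] at h2
    have h3 : (((Finset.range (M+1)).filter (fun n => n.Prime ∧ n ≠ 2)).filter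
        (fun p => m < fpt ε p)).card ≤ ((Finset.range (M+1)).filter
      (fun n => (n.Prime ∧ n ≠ 2) ∧ m < fpt ε n ∧ Q < n)).card + (Q + 1) := by
      rw [← Finset.card_range (Q+1)]
      refine le_trans (Finset.card_le_card ?_) (Finset.card_union_le _ _)
      intro n
      simp only [Finset.mem_filter, Finset.mem_range, Finset.mem_union]
      rintro ⟨⟨h1, h2⟩, h3⟩
      rcases lt_or_ge Q n with h4 | h4
      · exact Or.inl ⟨h1, h2, h3, h4⟩
      · exact Or.inr (by omega)
    have h3' : ((((Finset.range (M+1)).filter (fun n => n.Prime ∧ n ≠ 2)).filter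
        (fun p => m < fpt ε p)).card : ℝ) ≤ ((Finset.range (M+1)).filter
      (fun n => (n.Prime ∧ n ≠ 2) ∧ m < fpt ε n ∧ Q < n)).card + ((Q:ℝ) + 1) := by
      exact_mod_cast h3
    have : 0 ≤ c * x0 := by positivity
    linarith

open ArithmeticFunction.vonMangoldt in
lemma dens_bound {ε : ℝ} (hε : 0 < ε) {m : ℕ} (hm : 1 ≤ m) [NeZero (8 * m.factorial)] (L : ℝ)
    (hL : Filter.Tendsto (fun x : ℝ => aCoef ε m x) Filter.atTop (nhds L)) :
    L ≤ ∑ a : (ZMod (8 * m.factorial))ˣ,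
        ((S m (a : ZMod (8 * m.factorial)).val : ℝ) / (ε * m)) ^ 6 *
          ((8 * m.factorial).totient : ℝ)⁻¹ := by
  set Q := 8 * m.factorial with hQ
  set W : (ZMod Q)ˣ → ℝ := fun a => ((S m (a : ZMod Q).val : ℝ) / (ε * m)) ^ 6 with hW
  have hW0 : ∀ a, 0 ≤ W a := fun a => Even.pow_nonneg (by decide) _
  change L ≤ ∑ a, W a * (Q.totient : ℝ)⁻¹
  set B := ∑ a, W a * (Q.totient : ℝ)⁻¹ with hB
  have hB0 : 0 ≤ B := Finset.sum_nonneg fun a _ => mul_nonneg (hW0 a) (by positivity)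
  by_contra hcon
  push Not at hcon
  obtain ⟨c, hBc, hcL⟩ := exists_between hcon
  have hc0 : 0 < c := lt_of_le_of_lt hB0 hBc
  have hev : ∀ᶠ N : ℕ in atTop, c ≤ aCoef ε m (N : ℝ) :=
    ((hL.comp tendsto_natCast_atTop_atTop).eventually (lt_mem_nhds hcL)).mono
      fun N h => le_of_lt h
  obtain ⟨x0, hx0⟩ := eventually_atTop.1 hev
  set K : ℝ := (Q : ℝ) + 1 + c * x0 with hK
  have hK0 : 0 ≤ K := by positivity
  have hrc : ∀ a : (ZMod Q)ˣ, ∃ C : ℝ, ∀ x : ℝ, x ∈ Set.Ioc (1:ℝ) 2 →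
      ∑' n, residueClass (a : ZMod Q) n / (n : ℝ) ^ x ≤ (Q.totient : ℝ)⁻¹ / (x - 1) + C :=
    fun a => rc_bound a.isUnit
  choose Ca hCa using hrc
  obtain ⟨C1, hC1⟩ := LSeries_residueClass_lower_bound (q := 1) (a := 1) isUnit_one
  set T : ℝ := ∑' n : ℕ, (if n.Prime then 0 else residueClass (1 : ZMod 1) n) / n with hT
  have hTs := summable_residueClass_non_primes_div (1 : ZMod 1)
  have main : ∀ s : ℝ, s ∈ Set.Ioc (1:ℝ) 2 →
      (c - B) / (s - 1) ≤ c * C1 + (∑ a, W a * Ca a) + 2 * K + c * (T + 1) := by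
    intro s hs
    have hup : ∀ N, ∑ n ∈ Finset.range N,
        (if (n.Prime ∧ n ≠ 2) ∧ m < fpt ε n ∧ Q < n then gfun s n else 0) ≤
        B / (s - 1) + ∑ a, W a * Ca a := by
      intro N
      calc _ ≤ ∑ n ∈ Finset.range N, ∑ a, W a * (residueClass (a : ZMod Q) n / (n : ℝ) ^ s) :=
            Finset.sum_le_sum fun n _ => upper_pt hε hm n
        _ = ∑ a, W a * ∑ n ∈ Finset.range N, (residueClass (a : ZMod Q) n / (n : ℝ) ^ s) := by
            rw [Finset.sum_comm]; simp_rw [Finset.mul_sum]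
        _ ≤ ∑ a, W a * ((Q.totient : ℝ)⁻¹ / (s - 1) + Ca a) := by
            apply Finset.sum_le_sum
            intro a _
            apply mul_le_mul_of_nonneg_left _ (hW0 a)
            refine le_trans ?_ (hCa a s hs)
            exact (rc_summable (a : ZMod Q) hs.1).sum_le_tsum _
              fun n _ => div_nonneg (residueClass_nonneg _ _) (by positivity)
        _ = _ := by
            simp_rw [mul_add, Finset.sum_add_distrib]
            rw [hB, Finset.sum_div]
            simp_rw [mul_div_assoc]
    have hlow : ∀ N, ∑ n ∈ Finset.range N, residueClass (1 : ZMod 1) n / (n : ℝ) ^ s ≤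
        ∑ n ∈ Finset.range N, (if n.Prime ∧ n ≠ 2 then gfun s n else 0) + T + 1 := by
      intro N
      refine (Finset.sum_le_sum fun n _ => lower_pt hs.1 n).trans ?_
      rw [Finset.sum_add_distrib, Finset.sum_add_distrib]
      have h1 : ∑ n ∈ Finset.range N, (if n.Prime then 0 else residueClass (1 : ZMod 1) n) / n
          ≤ T := hTs.sum_le_tsum _ fun n _ => by
            apply div_nonneg _ (by positivity)
            split_ifs
            · exact le_rfl
            · exact residueClass_nonneg _ _
      have h2 : ∑ n ∈ Finset.range N, (if n = 2 then (1:ℝ) else 0) ≤ 1 := by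
        rw [Finset.sum_ite_eq']; split_ifs <;> norm_num
      linarith
    have hab := fun N => abel_bound _ (gfun s) K hK0 (gfun_anti hs.1) (gfun_nonneg s)
      (partial_lower hc0.le Q hx0) N
    have hcomb : ∀ N, ∑ n ∈ Finset.range N, residueClass (1 : ZMod 1) n / (n : ℝ) ^ s ≤
        (B / (s - 1) + ∑ a, W a * Ca a + 2 * K) / c + T + 1 := by
      intro N
      have h1 := hab N
      have h2 := hup N
      have h3 := hlow N
      have h4 := gfun_zero hs.1
      have h5 : ∑ n ∈ Finset.range N,
        ((if (n.Prime ∧ n ≠ 2) ∧ m < fpt ε n ∧ Q < n then (1:ℝ) else 0) -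
          c * (if n.Prime ∧ n ≠ 2 then 1 else 0)) * gfun s n =
          ∑ n ∈ Finset.range N,
            (if (n.Prime ∧ n ≠ 2) ∧ m < fpt ε n ∧ Q < n then gfun s n else 0) -
          c * ∑ n ∈ Finset.range N, (if n.Prime ∧ n ≠ 2 then gfun s n else 0) := by
        rw [Finset.mul_sum, ← Finset.sum_sub_distrib]
        apply Finset.sum_congr rfl
        intro n _
        simp only [sub_mul, ite_mul, one_mul, zero_mul, mul_ite, mul_one, mul_zero]
      rw [h5] at h1
      have h6 : ∑ n ∈ Finset.range N, (if n.Prime ∧ n ≠ 2 then gfun s n else 0) ≤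
          (B / (s - 1) + ∑ a, W a * Ca a + 2 * K) / c := by
        rw [le_div_iff₀ hc0]
        nlinarith
      linarith
    have hts := Real.tsum_le_of_sum_range_le
      (fun n => div_nonneg (residueClass_nonneg (1 : ZMod 1) n) (by positivity)) hcomb
    have hl := hC1 hs
    have hl' := hl.trans hts
    have h7 : c * (((Nat.totient 1 : ℕ) : ℝ)⁻¹ / (s - 1) - C1) ≤
        (B / (s - 1) + ∑ a, W a * Ca a + 2 * K) + c * (T + 1) := by
      calc _ ≤ c * ((B / (s - 1) + ∑ a, W a * Ca a + 2 * K) / c + T + 1) :=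
            mul_le_mul_of_nonneg_left hl' hc0.le
        _ = _ := by field_simp; ring
    simp only [Nat.totient_one, Nat.cast_one, inv_one] at h7
    have : (c - B) / (s - 1) = c * (1 / (s-1)) - B / (s - 1) := by ring
    rw [this]
    linarith
  set E := c * C1 + (∑ a, W a * Ca a) + 2 * K + c * (T + 1) with hE
  have hd : 0 < c - B := by linarith
  have hE1 : 0 < |E| + 1 := by positivity
  set r := min 1 ((c - B) / (|E| + 1)) with hr
  have hr0 : 0 < r := lt_min one_pos (by positivity)
  have := main (1 + r) ⟨by linarith, by linarith [min_le_left 1 ((c - B) / (|E| + 1))]⟩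
  rw [add_sub_cancel_left, div_le_iff₀ hr0] at this
  have h1 : r * (|E| + 1) ≤ c - B := by
    rw [← le_div_iff₀ hE1]; exact min_le_right _ _
  have h2 : E * r ≤ |E| * r := mul_le_mul_of_nonneg_right (le_abs_self E) hr0.le
  linarith

/-- For fixed `ε ∈ (0,1]`, `κ ∈ (0,1/6)`, `δ ∈ (0,1)`: if `â_m = lim_{x→∞} a_m(x)`, then
`â_m ≪_{ε,κ,δ} m^(-3+δ)` for `m ≥ 2`; in particular `∑_{m ≥ 0} â_m` converges. -/
theorem stmt16 (ε κ δ : ℝ) (hε : 0 < ε) (hε1 : ε ≤ 1) (hκ : 0 < κ) (hκ' : κ < 1/6)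
    (hδ : 0 < δ) (hδ1 : δ < 1) (ahat : ℕ → ℝ)
    (ha : ∀ m : ℕ, Filter.Tendsto (fun x : ℝ => aCoef ε m x) Filter.atTop (nhds (ahat m))) :
    (∃ C : ℝ, 0 < C ∧ ∀ m : ℕ, 2 ≤ m → |ahat m| ≤ C * (m : ℝ) ^ ((-3 : ℝ) + δ)) ∧
      Summable ahat := by
  have hmain : ∃ C : ℝ, 0 < C ∧ ∀ m : ℕ, 2 ≤ m → |ahat m| ≤ C * (m : ℝ) ^ ((-3 : ℝ) + δ) := by
    obtain ⟨C, hC0, hC⟩ := count_bound δ hδ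
    refine ⟨C / ε ^ 6, by positivity, fun m hm => ?_⟩
    have hm0 : (0:ℝ) < m := by exact_mod_cast (by omega : 0 < m)
    have hnn : 0 ≤ ahat m := ge_of_tendsto' (ha m) fun x => by unfold aCoef; positivity
    rw [abs_of_nonneg hnn]
    have hQ : 8 * m.factorial ≠ 0 := by have := m.factorial_pos; omega
    have : NeZero (8 * m.factorial) := ⟨hQ⟩
    have h1 := dens_bound hε (by omega : 1 ≤ m) (ahat m) (ha m)
    have h2 := moment_bound m
    have h3 := hC m (by omega)
    have hφ : (0:ℝ) < ((8 * m.factorial).totient : ℝ) := by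
      exact_mod_cast Nat.totient_pos.2 (Nat.pos_of_ne_zero hQ)
    have h2' : ∑ a : (ZMod (8 * m.factorial))ˣ,
        (S m (a : ZMod (8 * m.factorial)).val : ℝ) ^ 6 ≤
        ((8 * m.factorial).totient : ℝ) * (C * (m : ℝ) ^ (3 + δ)) := by
      refine le_trans ?_ (mul_le_mul_of_nonneg_left h3 hφ.le)
      exact_mod_cast h2
    calc ahat m ≤ _ := h1
      _ = (∑ a : (ZMod (8 * m.factorial))ˣ, (S m (a : ZMod (8 * m.factorial)).val : ℝ) ^ 6) *
          ((ε * m) ^ 6 * ((8 * m.factorial).totient : ℝ))⁻¹ := by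
          rw [Finset.sum_mul]
          apply Finset.sum_congr rfl
          intro a _
          rw [div_pow, mul_inv, div_eq_mul_inv, mul_assoc]
      _ ≤ (((8 * m.factorial).totient : ℝ) * (C * (m : ℝ) ^ (3 + δ))) *
          ((ε * m) ^ 6 * ((8 * m.factorial).totient : ℝ))⁻¹ :=
          mul_le_mul_of_nonneg_right h2' (by positivity)
      _ = C / ε ^ 6 * ((m : ℝ) ^ (3 + δ) / (m:ℝ) ^ 6) := by field_simp
      _ = C / ε ^ 6 * (m : ℝ) ^ ((-3 : ℝ) + δ) := by
          congr 1
          rw [← Real.rpow_natCast (m:ℝ) 6, ← Real.rpow_sub hm0]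
          congr 1; push_cast; ring
  refine ⟨hmain, ?_⟩
  obtain ⟨C, hC0, hC⟩ := hmain
  have hs : Summable (fun m : ℕ => C * (m : ℝ) ^ ((-3 : ℝ) + δ)) :=
    (Real.summable_nat_rpow.2 (by linarith)).mul_left C
  refine Summable.of_norm_bounded_eventually_nat hs ?_
  filter_upwards [eventually_ge_atTop 2] with m hm
  exact hC m hm

end
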